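/- arXiv:2411.07661 — 2 statements merged into one kernel-verified Lean document; each statement's English description precedes it below -/
import Mathlib

section
/- Under the hypotheses of the global convergence theorem for the algorithm with û^n = u^n, let (u^n)_n converge to u*, and assume A(x,y) = E(x) + (L/2 + 1/(3δt))‖x − y‖² is a KL function with exponent θ ∈ (0, 1/2], i.e., the KL inequality holds with ψ(s) = c·s^{1−θ}, c > 0. Then there exist constants c₁ > 0, n₁ > 0, and η ∈ (0,1) such that ‖u^n − u*‖ ≤ c₁ η^n for all n > n₁ (local linear convergence). -/
open scoped RealInnerProductSpace
open Filter Topology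

section Calculus

variable {X : Type*} [NormedAddCommGroup X] [InnerProductSpace ℝ X] [CompleteSpace X]

lemma HasGradientAt.hasDerivAt_line {F : X → ℝ} {g x d : X} {t : ℝ}
    (hF : HasGradientAt F g (x + t • d)) :
    HasDerivAt (fun s : ℝ => F (x + s • d)) ⟪g, d⟫ t := by
  have hline : HasDerivAt (fun s : ℝ => x + s • d) d t := by
    simpa using ((hasDerivAt_id t).smul_const d).const_add x
  have hcomp := hF.hasFDerivAt.comp_hasDerivAt t hline
  rw [InnerProductSpace.toDual_apply_apply] at hcomp
  exact hcomp

/-- First-order characterization of convexity. -/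
lemma ConvexOn.add_inner_le_of_hasGradientAt {H : X → ℝ} (hH : ConvexOn ℝ Set.univ H)
    {g x : X} (hg : HasGradientAt H g x) (z : X) : H x + ⟪g, z - x⟫ ≤ H z := by
  have hline : ConvexOn ℝ Set.univ (fun s : ℝ => H (x + s • (z - x))) := by
    have := hH.comp_affineMap (AffineMap.lineMap x z : ℝ →ᵃ[ℝ] X)
    simpa [Function.comp_def, AffineMap.lineMap_apply, add_comm] using this
  have hderiv : HasDerivAt (fun s : ℝ => H (x + s • (z - x))) ⟪g, z - x⟫ 0 :=
    HasGradientAt.hasDerivAt_line (by simpa using hg)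
  have := hline.le_slope_of_hasDerivAt (Set.mem_univ 0) (Set.mem_univ 1) one_pos hderiv
  simp [slope_def_field] at this
  linarith

/-- The descent lemma for functions with Lipschitz gradient. -/
lemma le_add_inner_add_sq_of_lipschitz_gradient {F : X → ℝ} {f : X → X}
    (hF : ∀ x, HasGradientAt F (f x) x) {L : ℝ}
    (hLip : ∀ x y, ‖f x - f y‖ ≤ L * ‖x - y‖) (x z : X) :
    F z ≤ F x + ⟪f x, z - x⟫ + L / 2 * ‖z - x‖ ^ 2 := by
  set d := z - x with hd
  have hderiv (t : ℝ) : HasDerivAt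
      (fun s : ℝ => F (x + s • d) - s * ⟪f x, d⟫ - s ^ 2 * (L / 2 * ‖d‖ ^ 2))
      (⟪f (x + t • d), d⟫ - 1 * ⟪f x, d⟫ - (2 * t) * (L / 2 * ‖d‖ ^ 2)) t := by
    refine ((hF _).hasDerivAt_line.sub ((hasDerivAt_id t).mul_const _)).sub ?_
    simpa using (hasDerivAt_pow 2 t).mul_const (L / 2 * ‖d‖ ^ 2)
  have hanti : AntitoneOn
      (fun s : ℝ => F (x + s • d) - s * ⟪f x, d⟫ - s ^ 2 * (L / 2 * ‖d‖ ^ 2)) (Set.Icc 0 1) := by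
    refine antitoneOn_of_deriv_nonpos (convex_Icc 0 1)
      (fun t _ => (hderiv t).continuousAt.continuousWithinAt)
      (fun t _ => (hderiv t).differentiableAt.differentiableWithinAt) fun t ht => ?_
    rw [interior_Icc] at ht
    rw [(hderiv t).deriv]
    have h1 : ⟪f (x + t • d) - f x, d⟫ ≤ L * (t * ‖d‖) * ‖d‖ := by
      refine (real_inner_le_norm _ _).trans ?_
      have := hLip (x + t • d) x
      rw [add_sub_cancel_left, norm_smul, Real.norm_of_nonneg ht.1.le] at this
      gcongr
    rw [inner_sub_left] at h1
    linarith
  have := hanti (Set.left_mem_Icc.2 zero_le_one) (Set.right_mem_Icc.2 zero_le_one) zero_le_one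
  simp [hd] at this
  simp only [hd]
  linarith

lemma hasGradientAt_norm_sub_sq (c x : X) :
    HasGradientAt (fun v => ‖v - c‖ ^ 2) ((2 : ℝ) • (x - c)) x := by
  rw [hasGradientAt_iff_hasFDerivAt]
  refine ((hasFDerivAt_id x).sub_const c).norm_sq.congr_fderiv ?_
  ext w
  simp

lemma HasGradientAt.add' {F G : X → ℝ} {f g x : X} (hF : HasGradientAt F f x)
    (hG : HasGradientAt G g x) : HasGradientAt (fun v => F v + G v) (f + g) x := by
  rw [hasGradientAt_iff_hasFDerivAt] at *
  rw [map_add]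
  exact hF.add hG

lemma HasGradientAt.const_mul' {F : X → ℝ} {f x : X} (hF : HasGradientAt F f x) (c : ℝ) :
    HasGradientAt (fun v => c * F v) (c • f) x := by
  rw [hasGradientAt_iff_hasFDerivAt] at *
  refine (hF.const_mul c).congr_fderiv ?_
  simp

lemma hasGradientAt_inner_sub (g c x : X) : HasGradientAt (fun v => ⟪g, v - c⟫) g x := by
  rw [hasGradientAt_iff_hasFDerivAt]
  refine ((InnerProductSpace.toDual ℝ X g).hasFDerivAt.comp x
    ((hasFDerivAt_id x).sub_const c)).congr_fderiv ?_
  ext w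
  simp

/-- Gradient of `(x, y) ↦ E x + a ‖x - y‖²` on the Euclidean product. -/
lemma hasGradientAt_add_mul_norm_sub_sq {E : X → ℝ} {g : X} (a : ℝ) (p : WithLp 2 (X × X))
    (hE : HasGradientAt E g p.fst) :
    HasGradientAt (fun q : WithLp 2 (X × X) => E q.fst + a * ‖q.fst - q.snd‖ ^ 2)
      (WithLp.toLp 2 (g + (2 * a) • (p.fst - p.snd), -((2 * a) • (p.fst - p.snd)))) p := by
  have h1 : HasFDerivAt (fun q : WithLp 2 (X × X) => q.fst) (WithLp.fstL 2 ℝ X X) p :=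
    (WithLp.fstL 2 ℝ X X).hasFDerivAt
  have h2 : HasFDerivAt (fun q : WithLp 2 (X × X) => q.snd) (WithLp.sndL 2 ℝ X X) p :=
    (WithLp.sndL 2 ℝ X X).hasFDerivAt
  rw [hasGradientAt_iff_hasFDerivAt] at hE ⊢
  refine ((hE.comp p h1).add ((h1.sub h2).norm_sq.const_mul a)).congr_fderiv ?_
  ext w
  simp [WithLp.prod_inner_apply, inner_add_left, inner_sub_left, inner_smul_left]
  ring

end Calculus

section Step

variable {X : Type*} [NormedAddCommGroup X] [InnerProductSpace ℝ X]

/-- One step of the convex splitting scheme decreases `E(u) + (L/2 + k) ‖u - u'‖²`, where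
`k = 1 / (3 δt)`. -/
lemma convexSplitting_step_decrease [CompleteSpace X] {H F : X → ℝ} {h f : X → X}
    (hH : ∀ x, HasGradientAt H (h x) x) (hHconv : ConvexOn ℝ Set.univ H)
    (hF : ∀ x, HasGradientAt F (f x) x) {L : ℝ} (hL : 0 < L)
    (hLip : ∀ x y, ‖f x - f y‖ ≤ L * ‖x - y‖) {k S lam : ℝ} (hk : L / 2 < k)
    (hlam : 0 ≤ lam) (hS : 1 + lam ≤ S) {w u y v m : X} (hm : 0 ≤ ⟪m, y - u⟫)
    (hopt : h y + (6 * k) • (y - u) - ((2 * k) • (u - w) - f u - (f u - f w)) + m = 0)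
    (hv : v - u = (1 + lam) • (y - u))
    (hls : H v + 3 * k * ‖v - u‖ ^ 2 - (k * ‖v - w‖ ^ 2 - F v - ⟪f u - f w, v - w⟫)
      ≤ H y + 3 * k * ‖y - u‖ ^ 2 - (k * ‖y - w‖ ^ 2 - F y - ⟪f u - f w, y - w⟫)) :
    H v + F v + (L / 2 + k) * ‖v - u‖ ^ 2 + ((4 * k - L / 2) / S ^ 2 - L) * ‖v - u‖ ^ 2
      ≤ H u + F u + (L / 2 + k) * ‖u - w‖ ^ 2 := by
  have hconv := hHconv.add_inner_le_of_hasGradientAt (hH y) u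
  have hdesc := le_add_inner_add_sq_of_lipschitz_gradient hF hLip u y
  have hvw : v - w = (v - u) + (u - w) := by abel
  have hyw : y - w = (y - u) + (u - w) := by abel
  have huy : u - y = -(y - u) := by abel
  rw [hvw, hyw, norm_add_sq_real, norm_add_sq_real, inner_add_right, inner_add_right] at hls
  rw [huy, inner_neg_right] at hconv
  have hg := hLip u w
  generalize f u - f w = g at *
  have hS2 : ‖v - u‖ ^ 2 / S ^ 2 ≤ ‖y - u‖ ^ 2 := by
    have hSpos : 0 < S := by linarith
    rw [div_le_iff₀ (by positivity), hv, norm_smul, Real.norm_of_nonneg (by linarith), mul_pow,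
      mul_comm]
    gcongr
  generalize y - u = d at *
  generalize v - u = e' at *
  generalize u - w = e at *
  have hin : ⟪h y + (6 * k) • d - ((2 * k) • e - f u - g) + m, d⟫ = 0 := by
    rw [hopt, inner_zero_left]
  simp only [inner_add_left, inner_sub_left, real_inner_smul_left,
    real_inner_self_eq_norm_sq] at hin
  rw [real_inner_comm e d] at hls
  have h1 : -⟪g, e'⟫ ≤ L / 2 * (‖e‖ ^ 2 + ‖e'‖ ^ 2) := by
    have := (neg_le_abs _).trans (abs_real_inner_le_norm g e')
    have h3 : ‖g‖ * ‖e'‖ ≤ L * ‖e‖ * ‖e'‖ := by gcongr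
    nlinarith [mul_nonneg hL.le (sq_nonneg (‖e‖ - ‖e'‖))]
  have h2 : k * (2 * ⟪e', e⟫) ≤ k * (‖e'‖ ^ 2 + ‖e‖ ^ 2) := by
    have := real_inner_le_norm e' e
    have hk0 : 0 < k := by linarith
    gcongr
    nlinarith [sq_nonneg (‖e‖ - ‖e'‖)]
  have h4 : (4 * k - L / 2) * (‖e'‖ ^ 2 / S ^ 2) ≤ (4 * k - L / 2) * ‖d‖ ^ 2 := by
    gcongr
    linarith
  have h5 : (4 * k - L / 2) / S ^ 2 * ‖e'‖ ^ 2 = (4 * k - L / 2) * (‖e'‖ ^ 2 / S ^ 2) := by ring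
  rw [sub_mul, h5]
  linarith

/-- The gradient of the energy is controlled by two consecutive increments. -/
lemma convexSplitting_norm_gradient_le {h f m : X → X} {L Lh k c lam : ℝ} (hLh : 0 ≤ Lh)
    (hk : 0 ≤ k) (hLip : ∀ x y, ‖f x - f y‖ ≤ L * ‖x - y‖)
    (hhLip : ∀ x y, ‖h x - h y‖ ≤ Lh * ‖x - y‖) (hlam : 0 ≤ lam) {w u y v : X}
    (hc : 0 ≤ c) (hm : ∀ d, ‖m d‖ ≤ c * ‖d‖)
    (hopt : h y + (6 * k) • (y - u) - ((2 * k) • (u - w) - f u - (f u - f w)) + m (y - u) = 0)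
    (hv : v - u = (1 + lam) • (y - u)) :
    ‖h u + f u‖ ≤ (Lh + 6 * k + c) * ‖v - u‖ + (2 * k + L) * ‖u - w‖ := by
  have hd : ‖y - u‖ ≤ ‖v - u‖ := by
    rw [hv, norm_smul, Real.norm_of_nonneg (by linarith)]
    nlinarith [norm_nonneg (y - u)]
  have heq : h u + f u = (h u - h y) - (6 * k) • (y - u) - m (y - u) + (2 * k) • (u - w)
      - (f u - f w) := by
    rw [← sub_eq_zero, ← hopt]; abel
  have h1 := hhLip u y
  rw [norm_sub_rev u y] at h1
  have h2 : ‖(6 * k) • (y - u)‖ = 6 * k * ‖y - u‖ := by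
    rw [norm_smul, Real.norm_of_nonneg (by positivity)]
  have h3 : ‖(2 * k) • (u - w)‖ = 2 * k * ‖u - w‖ := by
    rw [norm_smul, Real.norm_of_nonneg (by positivity)]
  have h4 : ‖h u + f u‖ ≤ ‖h u - h y‖ + ‖(6 * k) • (y - u)‖ + ‖m (y - u)‖ + ‖(2 * k) • (u - w)‖
      + ‖f u - f w‖ := by
    rw [heq]
    exact (norm_sub_le _ _).trans (add_le_add_left ((norm_add_le _ _).trans
      (add_le_add_left ((norm_sub_le _ _).trans (add_le_add_left (norm_sub_le _ _) _)) _)) _)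
  have h5 : (Lh + 6 * k + c) * ‖y - u‖ ≤ (Lh + 6 * k + c) * ‖v - u‖ := by gcongr
  linarith [hLip u w, hm (y - u)]

end Step

section Rate

lemma le_mul_sqrt_pow_of_two_step_le {r : ℕ → ℝ} {q : ℝ} (hq0 : 0 < q) (hq1 : q < 1)
    (hr0 : 0 ≤ r 0) (hr : r 1 ≤ r 0) (hstep : ∀ n, r (n + 2) ≤ q * r n) (n : ℕ) :
    r n ≤ r 0 / √q * √q ^ n := by
  have hs0 : 0 < √q := Real.sqrt_pos.2 hq0
  have hs1 : √q < 1 := by rw [Real.sqrt_lt' one_pos]; simpa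
  induction n using Nat.twoStepInduction with
  | zero => simpa using (le_div_iff₀ hs0).2 (mul_le_of_le_one_right hr0 hs1.le)
  | one => simpa [hs0.ne'] using hr
  | more n ih _ =>
    calc r (n + 2) ≤ q * r n := hstep n
      _ ≤ q * (r 0 / √q * √q ^ n) := by gcongr
      _ = r 0 / √q * √q ^ (n + 2) := by rw [pow_add, Real.sq_sqrt hq0.le]; ring

/-- Linear convergence of a sequence whose squared increments are dominated by the decrease of a
quantity contracting by a factor in two steps. -/
lemma exists_linear_rate_of_sufficient_decrease {X : Type*} [NormedAddCommGroup X]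
    {u : ℕ → X} {ustar : X} (hu : Tendsto u atTop (𝓝 ustar)) {r : ℕ → ℝ} {ρ q : ℝ}
    (hρ : 0 < ρ) (hr : ∀ n, 0 ≤ r n)
    (hdec : ∀ n, r (n + 1) + ρ * ‖u (n + 1) - u n‖ ^ 2 ≤ r n) (hq0 : 0 < q) (hq1 : q < 1)
    (hstep : ∀ n, r (n + 2) ≤ q * r n) :
    ∃ C, 0 ≤ C ∧ ∃ η ∈ Set.Ioo (0 : ℝ) 1, ∀ n, ‖u n - ustar‖ ≤ C * η ^ n := by
  have hs0 : 0 < √q := Real.sqrt_pos.2 hq0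
  have hs1 : √q < 1 := by rw [Real.sqrt_lt' one_pos]; simpa
  have hη0 : 0 < √(√q) := Real.sqrt_pos.2 hs0
  have hη1 : √(√q) < 1 := by rw [Real.sqrt_lt' one_pos]; simpa
  have hr1 : r 1 ≤ r 0 := by
    have := hdec 0
    have : 0 ≤ ρ * ‖u (0 + 1) - u 0‖ ^ 2 := by positivity
    linarith
  have hr0 := hr 0
  set C := √(r 0 / √q / ρ)
  have hinc (n : ℕ) : dist (u n) (u (n + 1)) ≤ C * √(√q) ^ n := by
    rw [dist_comm, dist_eq_norm]
    refine le_of_sq_le_sq ?_ (by positivity)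
    rw [mul_pow, Real.sq_sqrt (by positivity), ← pow_mul, mul_comm n, pow_mul,
      Real.sq_sqrt hs0.le, div_mul_eq_mul_div, le_div_iff₀ hρ, mul_comm _ ρ]
    linarith [hdec n, hr (n + 1), le_mul_sqrt_pow_of_two_step_le hq0 hq1 hr0 hr1 hstep n]
  refine ⟨C / (1 - √(√q)), div_nonneg (Real.sqrt_nonneg _) (by linarith), _, ⟨hη0, hη1⟩,
    fun n => ?_⟩
  rw [← dist_eq_norm, div_mul_eq_mul_div]
  exact dist_le_of_le_geometric_of_tendsto _ _ hη1 hinc hu n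

/-- A KL inequality with exponent at most `1/2` and a relative error bound give a two-step
contraction. -/
lemma two_step_contraction_of_KL {r₀ r₁ r₂ a b c C ρ θ : ℝ} (hc : 0 < c) (hC : 0 < C)
    (hρ : 0 < ρ) (hθ : θ ≤ 1 / 2) (hr₁ : 0 ≤ r₁) (hr₁' : r₁ ≤ 1)
    (h01 : r₁ + ρ * a ^ 2 ≤ r₀) (h12 : r₂ + ρ * b ^ 2 ≤ r₁)
    (hKL : 0 < r₁ → c * r₁ ^ θ ≤ C * (a + b)) :
    r₂ ≤ (2 * C ^ 2 / (c ^ 2 * ρ)) / (1 + 2 * C ^ 2 / (c ^ 2 * ρ)) * r₀ := by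
  have ha : 0 ≤ ρ * a ^ 2 := by positivity
  have hb : 0 ≤ ρ * b ^ 2 := by positivity
  have key : c ^ 2 * r₁ ≤ 2 * C ^ 2 * (a ^ 2 + b ^ 2) := by
    rcases hr₁.eq_or_lt with h0 | hpos
    · rw [← h0, mul_zero]; positivity
    have h1 : r₁ ^ (1 / 2 : ℝ) ≤ r₁ ^ θ := Real.rpow_le_rpow_of_exponent_ge hpos hr₁' hθ
    rw [← Real.sqrt_eq_rpow] at h1
    have h2 : c * √r₁ ≤ C * (a + b) := (by gcongr : c * √r₁ ≤ c * r₁ ^ θ).trans (hKL hpos)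
    have h3 : (c * √r₁) ^ 2 ≤ (C * (a + b)) ^ 2 := by gcongr
    rw [mul_pow, Real.sq_sqrt hr₁] at h3
    nlinarith [mul_nonneg (sq_nonneg C) (sq_nonneg (a - b))]
  have hK : r₁ ≤ 2 * C ^ 2 / (c ^ 2 * ρ) * (r₀ - r₂) := by
    rw [div_mul_eq_mul_div, le_div_iff₀ (by positivity)]
    nlinarith [mul_le_mul_of_nonneg_left key hρ.le, sq_nonneg C]
  set K := 2 * C ^ 2 / (c ^ 2 * ρ)
  have hKpos : 0 < K := by positivity
  rw [div_mul_eq_mul_div, le_div_iff₀ (by positivity)]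
  linarith

end Rate

/-- Local linear convergence when the KL exponent `θ ∈ (0, 1/2]`. -/
theorem linear_rate_theta_small
    {X : Type*} [NormedAddCommGroup X] [InnerProductSpace ℝ X] [FiniteDimensional ℝ X]
    (H : X → ℝ) (h : X → X) (hH : ∀ x : X, HasGradientAt H (h x) x)
    (hHconv : ConvexOn ℝ Set.univ H)
    (F : X → ℝ) (f : X → X) (hF : ∀ x : X, HasGradientAt F (f x) x)
    (L : ℝ) (hL : 0 < L) (hLip : ∀ x y : X, ‖f x - f y‖ ≤ L * ‖x - y‖)
    (Lh : ℝ) (hLh : 0 ≤ Lh) (hhLip : ∀ x y : X, ‖h x - h y‖ ≤ Lh * ‖x - y‖)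
    (δt : ℝ) (hδt : 0 < δt) (hδt2 : δt < 2 / (3 * L))
    (M : X →L[ℝ] X) (hMsym : ∀ x y : X, ⟪M x, y⟫ = ⟪x, M y⟫)
    (hMpsd : ∀ x : X, 0 ≤ ⟪M x, x⟫)
    (u y : ℕ → X) (lam : ℕ → ℝ) (α : ℝ) (hα : 0 < α)
    (Hn Fn En : ℕ → X → ℝ)
    (hHn : ∀ n : ℕ, ∀ v : X, Hn n v = H v + (1 / δt) * ‖v - u n‖ ^ 2)
    (hFn : ∀ n : ℕ, ∀ v : X, Fn n v = (1 / (3 * δt)) * ‖v - u (n - 1)‖ ^ 2 - F v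
      - ⟪f (u n) - f (u (n - 1)), v - u (n - 1)⟫)
    (hEn : ∀ n : ℕ, ∀ v : X, En n v = Hn n v - Fn n v)
    (hopt : ∀ n : ℕ, gradient (Hn n) (y n) - gradient (Fn n) (u n) + M (y n - u n) = 0)
    (hlam0 : ∀ n : ℕ, 0 ≤ lam n)
    (hls : ∀ n : ℕ, En n (y n + lam n • (y n - u n))
      ≤ En n (y n) - α * lam n * ‖y n - u n‖ ^ 2)
    (hupd : ∀ n : ℕ, u (n + 1) = y n + lam n • (y n - u n))
    (E : X → ℝ) (hE : ∀ v : X, E v = H v + F v)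
    (hlevel : ∀ c : ℝ, Bornology.IsBounded {x : X | E x ≤ c})
    (lamMax : ℝ) (hlamMax : ∀ n : ℕ, lam n ≤ lamMax)
    (hlamBound : lamMax < Real.sqrt (4 / (3 * δt * L) - 1 / 2) - 1)
    (Afun : WithLp 2 (X × X) → ℝ)
    (hAfun : ∀ p : WithLp 2 (X × X),
      Afun p = E (WithLp.equiv 2 (X × X) p).1
        + (L / 2 + 1 / (3 * δt))
          * ‖(WithLp.equiv 2 (X × X) p).1 - (WithLp.equiv 2 (X × X) p).2‖ ^ 2)
    (ustar : X) (hconv : Tendsto u atTop (𝓝 ustar))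
    (θ : ℝ) (hθ : θ ∈ Set.Ioc (0 : ℝ) (1 / 2))
    (hKL : ∀ xbar : WithLp 2 (X × X), gradient Afun xbar = 0 →
      ∃ cbar : ℝ, 0 < cbar ∧ ∃ ε : ℝ, 0 < ε ∧ ∃ ν : ℝ, 0 < ν ∧
        ∀ x : WithLp 2 (X × X), ‖x - xbar‖ ≤ ε → Afun xbar < Afun x →
          Afun x < Afun xbar + ν →
          cbar * (Afun x - Afun xbar) ^ θ ≤ ‖gradient Afun x‖) :
    ∃ c₁ : ℝ, 0 < c₁ ∧ ∃ η : ℝ, η ∈ Set.Ioo (0 : ℝ) 1 ∧ ∃ n₁ : ℕ,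
      ∀ n : ℕ, n₁ < n → ‖u n - ustar‖ ≤ c₁ * η ^ n := by
  have hLδ : 0 < 3 * δt * L := by positivity
  set k : ℝ := 1 / (3 * δt) with hkdef
  have hk3 : 1 / δt = 3 * k := by rw [hkdef]; field_simp
  have hkL : L / 2 < k := by
    rw [hkdef, lt_div_iff₀ (by positivity)]
    rw [lt_div_iff₀ (by positivity)] at hδt2
    linarith
  have hk0 : 0 < k := by linarith
  set S : ℝ := 1 + lamMax with hS
  have hS1 : 1 ≤ S := by linarith [(hlam0 0).trans (hlamMax 0)]
  have hρ : 0 < (4 * k - L / 2) / S ^ 2 - L := by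
    have h1 : S < √(4 / (3 * δt * L) - 1 / 2) := by linarith
    rw [Real.lt_sqrt (by linarith)] at h1
    have h2 : 4 / (3 * δt * L) * L = 4 * k := by rw [hkdef]; field_simp
    rw [sub_pos, lt_div_iff₀ (by positivity)]
    nlinarith
  set ρ : ℝ := (4 * k - L / 2) / S ^ 2 - L
  have hstepdir (n : ℕ) : u (n + 1) - u n = (1 + lam n) • (y n - u n) := by
    rw [hupd, add_smul, one_smul]; abel
  have hgradH (n : ℕ) : gradient (Hn n) (y n) = h (y n) + (6 * k) • (y n - u n) := by
    rw [funext (hHn n), ((hH (y n)).add'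
      ((hasGradientAt_norm_sub_sq (u n) (y n)).const_mul' (1 / δt))).gradient, smul_smul, hk3]
    ring_nf
  have hgradF (n : ℕ) : gradient (Fn n) (u n)
      = (2 * k) • (u n - u (n - 1)) - f (u n) - (f (u n) - f (u (n - 1))) := by
    have hfun : Fn n = fun v => k * ‖v - u (n - 1)‖ ^ 2
        + (-1 * F v + -1 * ⟪f (u n) - f (u (n - 1)), v - u (n - 1)⟫) := by
      funext v
      rw [hFn]; ring
    rw [hfun, (((hasGradientAt_norm_sub_sq _ _).const_mul' k).add'
      (((hF _).const_mul' (-1)).add'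
        ((hasGradientAt_inner_sub _ _ _).const_mul' (-1)))).gradient, smul_smul, mul_comm k]
    simp only [neg_smul, one_smul]
    abel
  have hopt' (n : ℕ) : h (y n) + (6 * k) • (y n - u n) - ((2 * k) • (u n - u (n - 1)) - f (u n)
      - (f (u n) - f (u (n - 1)))) + M (y n - u n) = 0 := by
    rw [← hgradH, ← hgradF]; exact hopt n
  set a : ℝ := L / 2 + k with ha
  have hdec (n : ℕ) : E (u (n + 1)) + a * ‖u (n + 1) - u n‖ ^ 2 + ρ * ‖u (n + 1) - u n‖ ^ 2
      ≤ E (u n) + a * ‖u n - u (n - 1)‖ ^ 2 := by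
    rw [hE, hE]
    refine convexSplitting_step_decrease hH hHconv hF hL hLip hkL (hlam0 n)
      (by linarith [hlamMax n]) (hMpsd _) (hopt' n) (hstepdir n) ?_
    have h1 := hls n
    have h2 : 0 ≤ α * lam n * ‖y n - u n‖ ^ 2 := by
      have := hlam0 n
      positivity
    rw [← hupd] at h1
    simp only [hEn, hHn, hFn, hk3] at h1
    linarith
  have hgrad (n : ℕ) : ‖h (u n) + f (u n)‖
      ≤ (Lh + 6 * k + ‖M‖) * ‖u (n + 1) - u n‖ + (2 * k + L) * ‖u n - u (n - 1)‖ :=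
    convexSplitting_norm_gradient_le hLh hk0.le hLip hhLip (hlam0 n) (norm_nonneg M)
      M.le_opNorm (hopt' n) (hstepdir n)
  have hinc : Tendsto (fun n => ‖u (n + 1) - u n‖) atTop (𝓝 0) := by
    simpa using ((hconv.comp (tendsto_add_atTop_nat 1)).sub hconv).norm
  have hinc' : Tendsto (fun n => ‖u n - u (n - 1)‖) atTop (𝓝 0) := by
    refine (tendsto_add_atTop_iff_nat 1).1 ?_
    simpa using hinc
  have hcont {g : X → X} {K : ℝ} (hK : 0 ≤ K) (hg : ∀ x y, ‖g x - g y‖ ≤ K * ‖x - y‖) :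
      Continuous g :=
    (LipschitzWith.of_dist_le_mul (K := ⟨K, hK⟩) fun x y => by
      rw [dist_eq_norm, dist_eq_norm]; exact hg x y).continuous
  have hcrit : h ustar + f ustar = 0 := by
    have h1 : Tendsto (fun n => ‖h (u n) + f (u n)‖) atTop (𝓝 ‖h ustar + f ustar‖) :=
      ((((hcont hLh hhLip).tendsto ustar).comp hconv).add
        (((hcont hL.le hLip).tendsto ustar).comp hconv)).norm
    have h2 : Tendsto (fun n => ‖h (u n) + f (u n)‖) atTop (𝓝 0) := by
      refine squeeze_zero (fun n => norm_nonneg _) hgrad ?_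
      simpa using (hinc.const_mul (Lh + 6 * k + ‖M‖)).add (hinc'.const_mul (2 * k + L))
    exact norm_eq_zero.1 (tendsto_nhds_unique h1 h2)
  have hEgrad (x : X) : HasGradientAt E (h x + f x) x := by
    rw [funext hE]; exact (hH x).add' (hF x)
  have hAgrad (p : WithLp 2 (X × X)) : gradient Afun p = WithLp.toLp 2
      (h p.fst + f p.fst + (2 * a) • (p.fst - p.snd), -((2 * a) • (p.fst - p.snd))) := by
    rw [funext hAfun]
    exact (hasGradientAt_add_mul_norm_sub_sq a p (hEgrad _)).gradient
  set xbar : WithLp 2 (X × X) := WithLp.toLp 2 (ustar, ustar) with hxbar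
  have hAbar : Afun xbar = E ustar := by rw [hAfun]; simp [hxbar]
  obtain ⟨cbar, hcbar, ε, hε, ν, hν, hKL'⟩ := hKL xbar (by rw [hAgrad]; simp [hxbar, hcrit])
  set x : ℕ → WithLp 2 (X × X) := fun n => WithLp.toLp 2 (u n, u (n - 1)) with hx
  have hAx (n : ℕ) : Afun (x n) = E (u n) + a * ‖u n - u (n - 1)‖ ^ 2 := by rw [hAfun]; rfl
  set C : ℝ := (Lh + 6 * k + ‖M‖) + (2 * k + L) + 4 * a with hC
  have hCpos : 0 < C := by positivity
  have hAxgrad (n : ℕ) : ‖gradient Afun (x n)‖ ≤ C * (‖u n - u (n - 1)‖ + ‖u (n + 1) - u n‖) := by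
    have h1 : ‖gradient Afun (x n)‖
        ≤ ‖h (u n) + f (u n) + (2 * a) • (u n - u (n - 1))‖ + ‖(2 * a) • (u n - u (n - 1))‖ := by
      rw [hAgrad, WithLp.prod_norm_eq_of_L2]
      refine Real.sqrt_le_iff.2 ⟨by positivity, ?_⟩
      simp only [hx, WithLp.toLp_fst, WithLp.toLp_snd, norm_neg]
      nlinarith [mul_nonneg (norm_nonneg (h (u n) + f (u n) + (2 * a) • (u n - u (n - 1))))
        (norm_nonneg ((2 * a) • (u n - u (n - 1))))]
    have h2 := norm_add_le (h (u n) + f (u n)) ((2 * a) • (u n - u (n - 1)))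
    have h3 : ‖(2 * a) • (u n - u (n - 1))‖ = 2 * a * ‖u n - u (n - 1)‖ := by
      rw [norm_smul, Real.norm_of_nonneg (by positivity)]
    have h4 : 0 ≤ (Lh + 6 * k + ‖M‖) * ‖u n - u (n - 1)‖ := by positivity
    have h5 : 0 ≤ (2 * k + L + 4 * a) * ‖u (n + 1) - u n‖ := by positivity
    rw [hC]
    linarith [hgrad n]
  have hxlim : Tendsto x atTop (𝓝 xbar) := by
    have h1 : Tendsto (fun n => u (n - 1)) atTop (𝓝 ustar) :=
      hconv.comp (tendsto_sub_atTop_nat 1)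
    exact ((WithLp.prod_continuous_toLp 2 X X).tendsto _).comp (hconv.prodMk_nhds h1)
  set r : ℕ → ℝ := fun n => Afun (x n) - E ustar with hrdef
  have hrdec (n : ℕ) : r (n + 1) + ρ * ‖u (n + 1) - u n‖ ^ 2 ≤ r n := by
    have := hdec n
    simp only [hrdef, hAx, Nat.add_sub_cancel]
    linarith
  have hrlim : Tendsto r atTop (𝓝 0) := by
    have h1 : Tendsto (fun n => E (u n)) atTop (𝓝 (E ustar)) :=
      (hEgrad ustar).continuousAt.tendsto.comp hconv
    simp only [hrdef, hAx]
    simpa using (h1.add ((hinc'.pow 2).const_mul a)).sub_const (E ustar)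
  have hranti : Antitone r := antitone_nat_of_succ_le fun n => by
    have : 0 ≤ ρ * ‖u (n + 1) - u n‖ ^ 2 := by positivity
    linarith [hrdec n]
  have hr0 (n : ℕ) : 0 ≤ r n := hranti.le_of_tendsto hrlim n
  obtain ⟨N, hN⟩ := eventually_atTop.1 (((hrlim.eventually (gt_mem_nhds hν)).and
    (hrlim.eventually (gt_mem_nhds one_pos))).and
      (hxlim.eventually (Metric.closedBall_mem_nhds xbar hε)))
  set K : ℝ := 2 * C ^ 2 / (cbar ^ 2 * ρ)
  have hK : 0 < K := by positivity
  have hstep (j : ℕ) : r (N + j + 2) ≤ K / (1 + K) * r (N + j) := by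
    obtain ⟨⟨hn1, hn2⟩, hn3⟩ := hN (N + j + 1) (by omega)
    refine two_step_contraction_of_KL hcbar hCpos hρ hθ.2 (hr0 (N + j + 1)) hn2.le
      (hrdec (N + j)) (hrdec (N + j + 1)) fun hpos => ?_
    have h1 := hKL' (x (N + j + 1)) (by simpa [dist_eq_norm] using hn3)
      (by rw [hAbar]; simpa [hrdef] using hpos)
      (by rw [hAbar]; simp only [hrdef] at hn1; linarith)
    rw [hAbar] at h1
    exact h1.trans (hAxgrad (N + j + 1))
  have huN : Tendsto (fun j => u (N + j)) atTop (𝓝 ustar) :=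
    by simpa [Function.comp_def, add_comm] using hconv.comp (tendsto_add_atTop_nat N)
  obtain ⟨C', hC', η, hη, hbound⟩ := exists_linear_rate_of_sufficient_decrease huN
    (r := fun j => r (N + j)) hρ (fun j => hr0 _) (fun j => hrdec (N + j))
    (q := K / (1 + K)) (by positivity) (by rw [div_lt_one (by positivity)]; linarith) hstep
  have hη0 := hη.1
  refine ⟨(C' + 1) / η ^ N, by positivity, η, hη, N, fun n hn => ?_⟩
  obtain ⟨j, rfl⟩ := Nat.exists_eq_add_of_le hn.le
  calc ‖u (N + j) - ustar‖ ≤ C' * η ^ j := hbound j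
    _ ≤ (C' + 1) * η ^ j := by gcongr; linarith
    _ = (C' + 1) / η ^ N * η ^ (N + j) := by rw [pow_add]; field_simp
end

section
/- Let (u^n)_{n≥0} be generated by the algorithm with û^n = ũ^n = (4/3)u^n − (1/3)u^{n−1} (optimality condition (2/(3δt))(3y^n − 4u^n + u^{n−1}) + M(y^n − ũ^n) + h(y^n) + 2f(u^n) − f(u^{n−1}) = 0, line search with parameter α > 0 and steps λ_n ≥ 0, u^{n+1} = y^n + λ_n d^n, and λ_max < min{√((8 − 3δtL)/(6δtL)) − 1, √5 − 1}). Assume h and f are Lipschitz continuous, E is level-bounded, and Ã(x,y) := E(x) + (L/2 + 1/(3δt))‖x − y‖² + (1/6)‖x − y‖_M² satisfies the Kurdyka–Łojasiewicz property at every critical point. Then lim_{n→∞} ‖∇Ã(u^{n+1}, u^n)‖ = 0, the sequence (Ã(u^{n+1}, u^n))_n is monotone decreasing with a limit, (u^n)_n is bounded, ∑_{n=0}^∞ ‖u^{n+1} − u^n‖ < ∞, and (u^n)_n converges to a critical point of E. -/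
open scoped RealInnerProductSpace
open Filter Topology

/-- A differentiable function `g` satisfies the Kurdyka–Łojasiewicz property at a critical
point `xbar`: there exist `ν > 0`, a neighborhood `O` of `xbar`, and a continuous concave
desingularizing function `ψ : [0, ν) → [0, ∞)` with `ψ 0 = 0`, continuously differentiable
with `ψ' > 0` on `(0, ν)`, such that `ψ'(g x - g xbar) ‖∇g x‖ ≥ 1` for all `x ∈ O` with
`g xbar < g x < g xbar + ν`. -/
def KLPropertyAt {Y : Type*} [NormedAddCommGroup Y] [InnerProductSpace ℝ Y]
    [CompleteSpace Y] (g : Y → ℝ) (xbar : Y) : Prop :=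
  ∃ ν : ℝ, 0 < ν ∧ ∃ O ∈ 𝓝 xbar, ∃ ψ ψ' : ℝ → ℝ,
    ContinuousOn ψ (Set.Ico 0 ν) ∧ ψ 0 = 0 ∧ (∀ s ∈ Set.Ico (0 : ℝ) ν, 0 ≤ ψ s) ∧
    ConcaveOn ℝ (Set.Ico 0 ν) ψ ∧
    (∀ s ∈ Set.Ioo (0 : ℝ) ν, HasDerivAt ψ (ψ' s) s ∧ 0 < ψ' s) ∧
    ContinuousOn ψ' (Set.Ioo 0 ν) ∧
    ∀ x ∈ O, g xbar < g x → g x < g xbar + ν → 1 ≤ ψ' (g x - g xbar) * ‖gradient g x‖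

section GradientInequalities

variable {X : Type*} [NormedAddCommGroup X] [InnerProductSpace ℝ X] [CompleteSpace X]

theorem HasGradientAt.hasDerivAt_comp_line {g : X → ℝ} {g' x d : X} {t : ℝ}
    (hg : HasGradientAt g g' (x + t • d)) :
    HasDerivAt (fun s : ℝ => g (x + s • d)) ⟪g', d⟫ t := by
  have hline : HasDerivAt (fun s : ℝ => x + s • d) d t := by
    simpa using ((hasDerivAt_id t).smul_const d).const_add x
  simpa [Function.comp_def] using! hg.hasFDerivAt.comp_hasDerivAt t hline

/-- A convex function lies above its tangent planes. -/
theorem ConvexOn.add_inner_gradient_le {g : X → ℝ} {g' x : X} (hconv : ConvexOn ℝ Set.univ g)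
    (hg : HasGradientAt g g' x) (z : X) : g x + ⟪g', z - x⟫ ≤ g z := by
  have hline : ConvexOn ℝ Set.univ (fun s : ℝ => g (x + s • (z - x))) := by
    have := hconv.comp_affineMap (AffineMap.lineMap x z : ℝ →ᵃ[ℝ] X)
    simpa [Function.comp_def, AffineMap.lineMap_apply_module', add_comm] using this
  have hderiv : HasDerivAt (fun s : ℝ => g (x + s • (z - x))) ⟪g', z - x⟫ 0 :=
    HasGradientAt.hasDerivAt_comp_line (by simpa using hg)
  have := hline.le_slope_of_hasDerivAt (Set.mem_univ _) (Set.mem_univ _) zero_lt_one hderiv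
  simp [slope_def_field] at this
  linarith

/-- The descent lemma: a function with `L`-Lipschitz gradient lies below the paraboloid of
curvature `L` that is tangent to it at any given point. -/
theorem le_add_inner_gradient_add_sq {g : X → ℝ} {g' : X → X} {L : ℝ}
    (hg : ∀ x, HasGradientAt g (g' x) x) (hLip : ∀ x y, ‖g' x - g' y‖ ≤ L * ‖x - y‖) (x z : X) :
    g z ≤ g x + ⟪g' x, z - x⟫ + L / 2 * ‖z - x‖ ^ 2 := by
  set d := z - x with hd
  have hφ (t : ℝ) : HasDerivAt (fun s : ℝ => g (x + s • d)) ⟪g' (x + t • d), d⟫ t :=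
    (hg _).hasDerivAt_comp_line
  have hB (t : ℝ) : HasDerivAt (fun s : ℝ => g x + s * ⟪g' x, d⟫ + L / 2 * s ^ 2 * ‖d‖ ^ 2)
      (⟪g' x, d⟫ + L * t * ‖d‖ ^ 2) t := by
    have := (((hasDerivAt_id t).mul_const ⟪g' x, d⟫).const_add (g x)).add
      ((((hasDerivAt_id t).pow 2).const_mul (L / 2)).mul_const (‖d‖ ^ 2))
    convert! this using 1
    simp only [id_eq, Nat.cast_ofNat]
    ring
  have key := image_le_of_deriv_right_le_deriv_boundary (a := 0) (b := 1)
    (fun t _ => (hφ t).continuousAt.continuousWithinAt)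
    (fun t _ => (hφ t).hasDerivWithinAt) (by simp)
    (fun t _ => (hB t).continuousAt.continuousWithinAt)
    (fun t _ => (hB t).hasDerivWithinAt)
    (fun t ht => by
      have h1 : ⟪g' (x + t • d) - g' x, d⟫ ≤ ‖g' (x + t • d) - g' x‖ * ‖d‖ :=
        real_inner_le_norm _ _
      have h2 : ‖g' (x + t • d) - g' x‖ ≤ L * (t * ‖d‖) := by
        simpa [norm_smul, abs_of_nonneg ht.1] using hLip (x + t • d) x
      rw [inner_sub_left] at h1
      nlinarith [mul_le_mul_of_nonneg_right h2 (norm_nonneg d)])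
    (Set.right_mem_Icc.2 zero_le_one)
  simpa [hd] using key

end GradientInequalities

section KurdykaLojasiewicz

variable {Y : Type*} [NormedAddCommGroup Y] [InnerProductSpace ℝ Y] [CompleteSpace Y]

theorem le_quarter_add_of_sq_le_of_one_le_mul {c C x s r G ψ' Δ : ℝ} (hc : 0 < c) (hC : 0 < C)
    (hs : 0 ≤ s) (hψ' : 0 < ψ') (hx : c * x ^ 2 ≤ r) (hG : G ≤ C * s) (hKL : 1 ≤ ψ' * G)
    (hΔ : ψ' * r ≤ Δ) : x ≤ s / 4 + C / c * Δ := by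
  have hr : 0 ≤ r := le_trans (by positivity) hx
  have hΔ0 : 0 ≤ Δ := le_trans (by positivity) hΔ
  have h1 : 1 ≤ ψ' * (C * s) := hKL.trans (by gcongr)
  have h2 : c * x ^ 2 ≤ C * s * Δ :=
    calc c * x ^ 2 ≤ r := hx
      _ ≤ r * (ψ' * (C * s)) := le_mul_of_one_le_right hr h1
      _ = C * s * (ψ' * r) := by ring
      _ ≤ C * s * Δ := by gcongr
  have h3 : x ^ 2 ≤ s * (C / c * Δ) := by
    rw [show s * (C / c * Δ) = C * s * Δ / c by ring, le_div_iff₀ hc]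
    linarith
  have hT : 0 ≤ C / c * Δ := by positivity
  refine abs_le_of_sq_le_sq' ?_ (by positivity) |>.2
  nlinarith [sq_nonneg (s / 4 - C / c * Δ)]

theorem tendsto_zero_of_sufficient_decrease {r a : ℕ → ℝ} {c ζ : ℝ} (hc : 0 < c)
    (hdesc : ∀ n, r (n + 1) + c * a (n + 1) ^ 2 ≤ r n) (hlim : Tendsto r atTop (𝓝 ζ)) :
    Tendsto a atTop (𝓝 0) := by
  rw [← tendsto_add_atTop_iff_nat 1]
  have hdiff : Tendsto (fun n => (r n - r (n + 1)) / c) atTop (𝓝 0) := by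
    simpa using (hlim.sub ((tendsto_add_atTop_iff_nat 1).2 hlim)).div_const c
  have hsq : Tendsto (fun n => a (n + 1) ^ 2) atTop (𝓝 0) := by
    refine squeeze_zero (fun n => sq_nonneg _) (fun n => ?_) hdiff
    rw [le_div_iff₀ hc]
    linarith [hdesc n]
  have := hsq.sqrt
  simp only [Real.sqrt_sq_eq_abs, Real.sqrt_zero] at this
  exact (tendsto_zero_iff_abs_tendsto_zero _).2 this

/-- A descent sequence whose gradients are controlled by its step sizes has finite length as
soon as it accumulates at a point where the Kurdyka–Łojasiewicz property holds. -/
theorem KLPropertyAt.summable_of_sufficient_decrease {g : Y → ℝ} {p : Y} {q : ℕ → Y} {a : ℕ → ℝ}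
    {c C : ℝ} (hKL : KLPropertyAt g p) (hc : 0 < c) (hC : 0 < C) (ha : ∀ n, 0 ≤ a n)
    (hdesc : ∀ n, g (q (n + 1)) + c * a (n + 1) ^ 2 ≤ g (q n))
    (hgrad : ∀ n, ‖gradient g (q (n + 1))‖ ≤ C * (a (n + 1) + a n))
    (hdist : ∀ n, dist (q (n + 1)) (q n) ≤ a (n + 1) + a n)
    (hp : MapClusterPt p atTop q) (hlim : Tendsto (fun n => g (q n)) atTop (𝓝 (g p))) :
    Summable a := by
  have hanti : Antitone fun n => g (q n) :=
    antitone_nat_of_succ_le fun n => by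
      have := hdesc n
      have : 0 ≤ c * a (n + 1) ^ 2 := by positivity
      linarith
  have hge (n : ℕ) : g p ≤ g (q n) := hanti.le_of_tendsto hlim n
  have ha0 : Tendsto a atTop (𝓝 0) := tendsto_zero_of_sufficient_decrease hc hdesc hlim
  by_cases hex : ∃ n, g (q n) = g p
  · obtain ⟨N, hN⟩ := hex
    refine summable_of_ne_finset_zero (s := Finset.range (N + 1)) fun n hn => ?_
    obtain ⟨m, rfl⟩ : ∃ m, n = m + 1 := ⟨n - 1, by simp at hn; omega⟩
    have hm : N ≤ m := by simp at hn; omega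
    have h1 : c * a (m + 1) ^ 2 ≤ 0 := by
      have h2 : g (q m) ≤ g (q N) := hanti hm
      linarith [hdesc m, hge (m + 1)]
    have : a (m + 1) ^ 2 ≤ 0 := nonpos_of_mul_nonpos_right h1 hc
    exact pow_eq_zero_iff two_ne_zero |>.1 (le_antisymm this (sq_nonneg _))
  push Not at hex
  have hgt (n : ℕ) : g p < g (q n) := lt_of_le_of_ne (hge n) (hex n).symm
  obtain ⟨ν, hν, O, hO, ψ, ψ', hψc, hψ0, hψnn, hψconc, hψd, -, hψ⟩ := hKL
  obtain ⟨ρ, hρ, hρO⟩ := Metric.mem_nhds_iff.1 hO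
  set r : ℕ → ℝ := fun n => g (q n) - g p with hr
  have hr0 : Tendsto r atTop (𝓝 0) := by simpa [hr] using hlim.sub_const (g p)
  have hrpos (n : ℕ) : 0 < r n := sub_pos.2 (hgt n)
  have hrν : ∀ᶠ n in atTop, r n < ν := hr0.eventually_lt_const hν
  have hψr : Tendsto (fun n => ψ (r n)) atTop (𝓝 0) := by
    have h1 := hψc 0 ⟨le_rfl, hν⟩
    rw [ContinuousWithinAt, hψ0] at h1
    refine h1.comp (tendsto_nhdsWithin_iff.2 ⟨hr0, ?_⟩)
    filter_upwards [hrν] with n hn using ⟨(hrpos n).le, hn⟩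
  set K := C / c with hK
  have hKpos : 0 < K := by positivity
  set V : ℕ → ℝ := fun n => K * ψ (r (n + 1)) + a (n + 1) / 2 + a n / 4 with hV
  have ha1 := (tendsto_add_atTop_iff_nat 1).2 ha0
  have hV0 : Tendsto V atTop (𝓝 0) := by
    simpa using ((((tendsto_add_atTop_iff_nat 1).2 hψr).const_mul K).add (ha1.div_const 2)).add
      (ha0.div_const 4)
  have hW0 : Tendsto (fun n => a (n + 1) + 4 * V n) atTop (𝓝 0) := by
    simpa using ha1.add (hV0.const_mul 4)
  obtain ⟨N₀, hN₀⟩ := eventually_atTop.1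
    (hrν.and (hW0.eventually_lt_const (half_pos hρ)))
  obtain ⟨N, hNge, hNball⟩ :=
    (frequently_atTop.1 (hp.frequently (Metric.ball_mem_nhds p (half_pos hρ)))) (N₀ + 1)
  obtain ⟨N, rfl⟩ : ∃ m, N = m + 1 := ⟨N - 1, by omega⟩
  have hrlt (n : ℕ) (hn : N ≤ n) : r n < ν := (hN₀ n (by omega)).1
  have hVnn (n : ℕ) (hn : N ≤ n) : 0 ≤ V n := by
    have h1 := hψnn (r (n + 1)) ⟨(hrpos _).le, hrlt _ (by omega)⟩
    have := ha n
    have := ha (n + 1)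
    positivity
  have hstep (n : ℕ) (hn : N ≤ n) (hball : q (n + 1) ∈ Metric.ball p ρ) :
      V (n + 1) + a (n + 2) / 2 ≤ V n := by
    have hmem : r (n + 1) ∈ Set.Ioo 0 ν := ⟨hrpos _, hrlt _ (by omega)⟩
    have hmem' : r (n + 2) ∈ Set.Ico 0 ν := ⟨(hrpos _).le, hrlt _ (by omega)⟩
    have hle : r (n + 2) ≤ r (n + 1) := sub_le_sub_right (hanti (Nat.le_succ (n + 1))) _
    have hconc : ψ' (r (n + 1)) * (r (n + 1) - r (n + 2)) ≤ ψ (r (n + 1)) - ψ (r (n + 2)) := by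
      rcases hle.eq_or_lt with heq | hlt
      · simp [heq]
      · have := hψconc.le_slope_of_hasDerivAt hmem' ⟨hmem.1.le, hmem.2⟩ hlt (hψd _ hmem).1
        rwa [slope_def_field, le_div_iff₀ (sub_pos.2 hlt)] at this
    have hx : c * a (n + 2) ^ 2 ≤ r (n + 1) - r (n + 2) := by
      have := hdesc (n + 1)
      simp only [hr]
      linarith
    have hkl := hψ (q (n + 1)) (hρO hball) (hgt _) (by linarith [hmem.2])
    have := le_quarter_add_of_sq_le_of_one_le_mul hc hC (add_nonneg (ha (n + 1)) (ha n))
      (hψd _ hmem).2 hx (hgrad n) hkl hconc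
    simp only [hV]
    linarith
  have hstay (k : ℕ) :
      dist (q (N + k + 1)) p + a (N + k + 1) + 4 * V (N + k) < ρ := by
    induction k with
    | zero =>
      have h1 := (hN₀ N (by omega)).2
      have h2 := Metric.mem_ball.1 hNball
      simp only [add_zero]
      linarith
    | succ k ih =>
      have hball : q (N + k + 1) ∈ Metric.ball p ρ := by
        rw [Metric.mem_ball]
        linarith [ha (N + k + 1), hVnn (N + k) (by omega)]
      have h1 := hstep (N + k) (by omega) hball
      have h2 := dist_triangle (q (N + k + 1 + 1)) (q (N + k + 1)) p
      have h3 := hdist (N + k + 1)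
      simp only [← add_assoc] at *
      linarith
  have hdec (k : ℕ) : V (N + k + 1) + a (N + k + 2) / 2 ≤ V (N + k) :=
    hstep (N + k) (by omega) (by
      rw [Metric.mem_ball]
      linarith [hstay k, ha (N + k + 1), hVnn (N + k) (by omega)])
  rw [← summable_nat_add_iff (N + 2)]
  refine summable_of_sum_range_le (c := 2 * V N) (fun n => ha _) fun n => ?_
  have hsum : ∑ i ∈ Finset.range n, a (i + (N + 2)) ≤ 2 * (V N - V (N + n)) := by
    induction n with
    | zero => simp
    | succ n ih =>
      rw [Finset.sum_range_succ, show n + (N + 2) = N + n + 2 by ring]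
      have := hdec n
      rw [← add_assoc]
      linarith
  linarith [hVnn (N + n) (by omega)]

end KurdykaLojasiewicz

section Scheme

variable {X : Type*} [NormedAddCommGroup X] [InnerProductSpace ℝ X]

theorem hasGradientAt_add_half_inner_sub [CompleteSpace X] {g : X → ℝ} {g' x : X}
    (hg : HasGradientAt g g' x) {G : X →L[ℝ] X} (hG : ∀ v w : X, ⟪G v, w⟫ = ⟪v, G w⟫) (w : X) :
    HasGradientAt
      (fun p : WithLp 2 (X × X) => g p.fst + 1 / 2 * ⟪G (p.fst - p.snd), p.fst - p.snd⟫)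
      (WithLp.toLp 2 (g' + G (x - w), -G (x - w))) (WithLp.toLp 2 (x, w)) := by
  rw [hasGradientAt_iff_hasFDerivAt]
  have hfst : HasFDerivAt (fun p : WithLp 2 (X × X) => p.fst) (WithLp.fstL 2 ℝ X X)
      (WithLp.toLp 2 (x, w)) := (WithLp.fstL 2 ℝ X X).hasFDerivAt
  have hsnd : HasFDerivAt (fun p : WithLp 2 (X × X) => p.snd) (WithLp.sndL 2 ℝ X X)
      (WithLp.toLp 2 (x, w)) := (WithLp.sndL 2 ℝ X X).hasFDerivAt
  have hg1 : HasFDerivAt (fun p : WithLp 2 (X × X) => g p.fst) _ (WithLp.toLp 2 (x, w)) :=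
    HasFDerivAt.comp (WithLp.toLp 2 (x, w)) (f := fun p : WithLp 2 (X × X) => p.fst)
      hg.hasFDerivAt hfst
  have hsub := hfst.sub hsnd
  have hq := ((G.hasFDerivAt.comp _ hsub).inner ℝ hsub).const_mul (1 / 2 : ℝ)
  refine (hg1.add hq).congr_fderiv ?_
  ext p
  simp [WithLp.prod_inner_apply, fderivInnerCLM_apply, inner_add_left, inner_sub_right]
  have hcomm (a b : X) : ⟪G a, b⟫ = ⟪G b, a⟫ := by rw [hG, real_inner_comm]
  simp only [inner_sub_left]
  rw [hcomm p.fst x, hcomm p.fst w, hcomm p.snd x, hcomm p.snd w]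
  ring

/-- One step of the boosted difference-of-convex scheme decreases the modified energy. -/
theorem modified_energy_descent [CompleteSpace X]
    {H F : X → ℝ} {h f : X → X} {L δt : ℝ} {M : X →L[ℝ] X}
    (hH : ∀ x, HasGradientAt H (h x) x) (hHconv : ConvexOn ℝ Set.univ H)
    (hF : ∀ x, HasGradientAt F (f x) x) (hLip : ∀ x y, ‖f x - f y‖ ≤ L * ‖x - y‖)
    (hL : 0 ≤ L) (hδt : 0 < δt) (hδL : 3 * δt * L ≤ 8)
    (hMsym : ∀ x y : X, ⟪M x, y⟫ = ⟪x, M y⟫) (hMpsd : ∀ x : X, 0 ≤ ⟪M x, x⟫)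
    {z v y v' : X} {l Λ : ℝ} (hl : 0 ≤ l) (hlΛ : l ≤ Λ) (hΛ : (1 + Λ) ^ 2 ≤ 5)
    (hopt : (2 / (3 * δt)) • ((3 : ℝ) • y - (4 : ℝ) • v + z)
        + M (y - ((4 / 3 : ℝ) • v - (1 / 3 : ℝ) • z)) + h y + (2 : ℝ) • f v - f z = 0)
    (hv' : v' = y + l • (y - v))
    (hls : H v' + F v' + 1 / δt * ‖v' - v‖ ^ 2 - 1 / (3 * δt) * ‖v' - z‖ ^ 2
        + ⟪f v - f z, v' - z⟫
      ≤ H y + F y + 1 / δt * ‖y - v‖ ^ 2 - 1 / (3 * δt) * ‖y - z‖ ^ 2 + ⟪f v - f z, y - z⟫) :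
    H v' + F v' + (L / 2 + 1 / (3 * δt)) * ‖v' - v‖ ^ 2 + 1 / 6 * ⟪M (v' - v), v' - v⟫
        + ((4 / (3 * δt) - L / 2) / (1 + Λ) ^ 2 - L) * ‖v' - v‖ ^ 2
      ≤ H v + F v + (L / 2 + 1 / (3 * δt)) * ‖v - z‖ ^ 2 + 1 / 6 * ⟪M (v - z), v - z⟫ := by
  obtain ⟨d, rfl⟩ : ∃ d, y = v + d := ⟨y - v, by abel⟩
  obtain ⟨b, rfl⟩ : ∃ b, z = v - b := ⟨v - z, by abel⟩
  have hv'd : v' - v = (1 + l) • d := by rw [hv']; module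
  have hy1 : v + d - v = d := by abel
  have hy2 : v + d - (v - b) = b + d := by abel
  have hz1 : v - (v - b) = b := by abel
  have hv'b : v' - (v - b) = b + (1 + l) • d := by rw [hv']; module
  rw [hv'd, hv'b, hy1, hy2] at hls
  rw [hv'd, hz1]
  have h1 := hHconv.add_inner_gradient_le (hH (v + d)) v
  have h2 := le_add_inner_gradient_add_sq hF hLip v (v + d)
  rw [show v - (v + d) = -d by abel, inner_neg_right] at h1
  rw [hy1] at h2
  -- the optimality condition tested against `d`
  have h3 : ⟪h (v + d), d⟫ = -(2 / (3 * δt)) * (3 * ‖d‖ ^ 2 - ⟪b, d⟫) - ⟪M d, d⟫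
      + 1 / 3 * ⟪M b, d⟫ - 2 * ⟪f v, d⟫ + ⟪f (v - b), d⟫ := by
    have e1 : (3 : ℝ) • (v + d) - (4 : ℝ) • v + (v - b) = (3 : ℝ) • d - b := by module
    have e2 : v + d - ((4 / 3 : ℝ) • v - (1 / 3 : ℝ) • (v - b)) = d - (1 / 3 : ℝ) • b := by module
    rw [e1, e2] at hopt
    have := congrArg (fun x => ⟪x, d⟫) hopt
    simp only [inner_add_left, inner_sub_left, inner_smul_left, map_sub, map_smul,
      inner_zero_left, real_inner_self_eq_norm_sq, RCLike.conj_to_real] at this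
    linarith
  have hM1 : ⟪M b, d⟫ ≤ 1 / 2 * ⟪M b, b⟫ + 1 / 2 * ⟪M d, d⟫ := by
    have := hMpsd (b - d)
    simp only [map_sub, inner_sub_left, inner_sub_right] at this
    rw [hMsym d b, real_inner_comm (M b) d] at this
    linarith
  have hf1 : -(L / 2 * (‖b‖ ^ 2 + ((1 + l) * ‖d‖) ^ 2)) ≤ (1 + l) * ⟪f v - f (v - b), d⟫ := by
    have e1 := (abs_le.1 (abs_real_inner_le_norm (f v - f (v - b)) d)).1
    have e2 := hLip v (v - b)
    rw [hz1] at e2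
    have e3 := mul_le_mul_of_nonneg_right e2 (norm_nonneg d)
    have e5 : L * ‖b‖ * ((1 + l) * ‖d‖) ≤ L / 2 * (‖b‖ ^ 2 + ((1 + l) * ‖d‖) ^ 2) := by
      nlinarith [mul_nonneg hL (sq_nonneg (‖b‖ - (1 + l) * ‖d‖))]
    have e6 : (1 + l) * -(L * ‖b‖ * ‖d‖) ≤ (1 + l) * ⟪f v - f (v - b), d⟫ := by
      gcongr
      linarith
    linarith
  have hn1 : ‖(1 + l) • d‖ ^ 2 = (1 + l) ^ 2 * ‖d‖ ^ 2 := by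
    rw [norm_smul, mul_pow, Real.norm_eq_abs, sq_abs]
  have hb1 : ‖b + (1 + l) • d‖ ^ 2 ≤ 2 * ‖b‖ ^ 2 + 2 * ((1 + l) ^ 2 * ‖d‖ ^ 2) := by
    have e1 := parallelogram_law_with_norm ℝ b ((1 + l) • d)
    nlinarith [mul_self_nonneg ‖b - (1 + l) • d‖]
  obtain ⟨θ, hθ⟩ : ∃ θ, θ = 1 / (3 * δt) := ⟨_, rfl⟩
  have hθ0 : 0 < θ := by rw [hθ]; positivity
  have hθ1 : 1 / δt = 3 * θ := by rw [hθ]; field_simp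
  have hθ2 : 2 / (3 * δt) = 2 * θ := by rw [hθ]; ring
  have hθ4 : 4 / (3 * δt) = 4 * θ := by rw [hθ]; ring
  have hθL : 0 ≤ 4 * θ - L / 2 := by
    rw [hθ, sub_nonneg, mul_one_div, le_div_iff₀ (by positivity)]
    linarith
  have hlsq : (1 + l) ^ 2 ≤ (1 + Λ) ^ 2 := by gcongr
  have hratio : (4 * θ - L / 2) / (1 + Λ) ^ 2 * ((1 + l) ^ 2 * ‖d‖ ^ 2)
      ≤ (4 * θ - L / 2) * ‖d‖ ^ 2 := by
    rw [← mul_assoc, div_mul_eq_mul_div]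
    gcongr
    rw [div_le_iff₀ (by nlinarith)]
    gcongr
  have hMd : (1 + l) ^ 2 * ⟪M d, d⟫ ≤ 5 * ⟪M d, d⟫ :=
    mul_le_mul_of_nonneg_right (hlsq.trans hΛ) (hMpsd d)
  have hθb := mul_le_mul_of_nonneg_left hb1 hθ0.le
  rw [hθ2] at h3
  rw [hθ1, ← hθ, hn1, norm_add_sq_real b d] at hls
  rw [hθ4, ← hθ, hn1]
  simp only [map_smul, inner_add_right, inner_smul_left, inner_smul_right, inner_sub_left,
    RCLike.conj_to_real] at hls hf1 ⊢
  linarith only [hls, h1, h2, h3, hM1, hf1, hratio, hMd, hθb]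

/-- The residual of the stationarity condition at the new iterate is controlled by the last two
step lengths. -/
theorem norm_gradient_le_of_optimality {h f : X → X} {L Lh δt : ℝ} {M : X →L[ℝ] X}
    (hLh : 0 ≤ Lh) (hδt : 0 < δt)
    (hLip : ∀ x y, ‖f x - f y‖ ≤ L * ‖x - y‖) (hhLip : ∀ x y, ‖h x - h y‖ ≤ Lh * ‖x - y‖)
    {z v y v' : X} {l : ℝ} (hl : 0 ≤ l)
    (hopt : (2 / (3 * δt)) • ((3 : ℝ) • y - (4 : ℝ) • v + z)
        + M (y - ((4 / 3 : ℝ) • v - (1 / 3 : ℝ) • z)) + h y + (2 : ℝ) • f v - f z = 0)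
    (hv' : v' = y + l • (y - v)) :
    ‖h v' + f v'‖ ≤ (2 / δt + ‖M‖ + Lh + L) * (‖v' - v‖ + ‖v - z‖) := by
  have hv'd : v' - v = (1 + l) • (y - v) := by rw [hv']; module
  have hna : ‖v' - v‖ = (1 + l) * ‖y - v‖ := by
    rw [hv'd, norm_smul, Real.norm_of_nonneg (by positivity)]
  have hd : ‖y - v‖ ≤ ‖v' - v‖ := by rw [hna]; nlinarith [norm_nonneg (y - v)]
  have hv'y : ‖v' - y‖ ≤ ‖v' - v‖ := by
    rw [hna, show v' - y = l • (y - v) by rw [hv']; module, norm_smul, Real.norm_of_nonneg hl]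
    nlinarith [norm_nonneg (y - v)]
  set A := ‖v' - v‖
  set B := ‖v - z‖
  have hA : 0 ≤ A := norm_nonneg _
  have hB : 0 ≤ B := norm_nonneg _
  have hsplit : h v' + f v' = (h v' - h y) + (f v' - f v) - (f v - f z)
      - (2 / (3 * δt)) • ((3 : ℝ) • (y - v) - (v - z))
      - M ((y - v) - (1 / 3 : ℝ) • (v - z)) := by
    rw [show (3 : ℝ) • (y - v) - (v - z) = (3 : ℝ) • y - (4 : ℝ) • v + z by module,
      show (y - v) - (1 / 3 : ℝ) • (v - z) = y - ((4 / 3 : ℝ) • v - (1 / 3 : ℝ) • z) by module,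
      ← sub_eq_zero, ← hopt]
    module
  have t1 : ‖h v' - h y‖ ≤ Lh * A := (hhLip _ _).trans (by gcongr)
  have t2 : ‖f v' - f v‖ ≤ L * A := hLip _ _
  have t3 : ‖f v - f z‖ ≤ L * B := hLip _ _
  have t4 : ‖(2 / (3 * δt)) • ((3 : ℝ) • (y - v) - (v - z))‖ ≤ 2 / (3 * δt) * (3 * A + B) := by
    rw [norm_smul, Real.norm_of_nonneg (by positivity)]
    gcongr
    refine (norm_sub_le _ _).trans ?_
    rw [norm_smul, Real.norm_of_nonneg (by positivity)]
    gcongr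
  have t5 : ‖M ((y - v) - (1 / 3 : ℝ) • (v - z))‖ ≤ ‖M‖ * (A + B) := by
    refine (M.le_opNorm _).trans ?_
    gcongr
    refine (norm_sub_le _ _).trans ?_
    rw [norm_smul, Real.norm_of_nonneg (by positivity)]
    change _ + 1 / 3 * B ≤ _
    linarith
  rw [hsplit]
  have e : 2 / (3 * δt) * (3 * A + B) ≤ 2 / δt * (A + B) := by
    rw [show 2 / (3 * δt) * (3 * A + B) = 2 / δt * (A + B / 3) by field_simp]
    gcongr
    linarith
  have := mul_nonneg hLh hB
  calc _ ≤ ‖h v' - h y‖ + ‖f v' - f v‖ + ‖f v - f z‖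
        + ‖(2 / (3 * δt)) • ((3 : ℝ) • (y - v) - (v - z))‖
        + ‖M ((y - v) - (1 / 3 : ℝ) • (v - z))‖ :=
        (norm_sub_le _ _).trans <| add_le_add_left ((norm_sub_le _ _).trans <|
          add_le_add_left ((norm_sub_le _ _).trans <| add_le_add_left (norm_add_le _ _) _) _) _
    _ ≤ _ := by linarith

end Scheme

/-- Global convergence of the algorithm with the extrapolated starting
point `ûⁿ = ũⁿ = (4/3)uⁿ - (1/3)uⁿ⁻¹`, using the modified auxiliary function
`Ã(x,y) = E(x) + (L/2 + 1/(3δt))‖x - y‖² + (1/6)‖x - y‖²_M` on the Hilbert product space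
`WithLp 2 (X × X)`. -/
theorem global_convergence_util
    {X : Type*} [NormedAddCommGroup X] [InnerProductSpace ℝ X] [FiniteDimensional ℝ X]
    (H : X → ℝ) (h : X → X) (hH : ∀ x : X, HasGradientAt H (h x) x)
    (hHconv : ConvexOn ℝ Set.univ H)
    (F : X → ℝ) (f : X → X) (hF : ∀ x : X, HasGradientAt F (f x) x)
    (L : ℝ) (hL : 0 < L) (hLip : ∀ x y : X, ‖f x - f y‖ ≤ L * ‖x - y‖)
    (Lh : ℝ) (hLh : 0 ≤ Lh) (hhLip : ∀ x y : X, ‖h x - h y‖ ≤ Lh * ‖x - y‖)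
    (δt : ℝ) (hδt : 0 < δt) (hδt2 : δt < 2 / (3 * L))
    (M : X →L[ℝ] X) (hMsym : ∀ x y : X, ⟪M x, y⟫ = ⟪x, M y⟫)
    (hMpsd : ∀ x : X, 0 ≤ ⟪M x, x⟫)
    (u y : ℕ → X) (lam : ℕ → ℝ) (α : ℝ) (hα : 0 < α)
    (Hn Fn En : ℕ → X → ℝ)
    (hHn : ∀ n : ℕ, ∀ v : X, Hn n v = H v + (1 / δt) * ‖v - u n‖ ^ 2)
    (hFn : ∀ n : ℕ, ∀ v : X, Fn n v = (1 / (3 * δt)) * ‖v - u (n - 1)‖ ^ 2 - F v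
      - ⟪f (u n) - f (u (n - 1)), v - u (n - 1)⟫)
    (hEn : ∀ n : ℕ, ∀ v : X, En n v = Hn n v - Fn n v)
    (hopt : ∀ n : ℕ,
      (2 / (3 * δt)) • ((3 : ℝ) • y n - (4 : ℝ) • u n + u (n - 1))
        + M (y n - ((4 / 3 : ℝ) • u n - (1 / 3 : ℝ) • u (n - 1)))
        + h (y n) + (2 : ℝ) • f (u n) - f (u (n - 1)) = 0)
    (hlam0 : ∀ n : ℕ, 0 ≤ lam n)
    (hls : ∀ n : ℕ, En n (y n + lam n • (y n - u n))
      ≤ En n (y n) - α * lam n * ‖y n - u n‖ ^ 2)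
    (hupd : ∀ n : ℕ, u (n + 1) = y n + lam n • (y n - u n))
    (E : X → ℝ) (hE : ∀ v : X, E v = H v + F v)
    (hlevel : ∀ c : ℝ, Bornology.IsBounded {x : X | E x ≤ c})
    (lamMax : ℝ) (hlamMax : ∀ n : ℕ, lam n ≤ lamMax)
    (hlamBound : lamMax <
      min (Real.sqrt ((8 - 3 * δt * L) / (6 * δt * L)) - 1) (Real.sqrt 5 - 1))
    (Atil : WithLp 2 (X × X) → ℝ)
    (hAtil : ∀ p : WithLp 2 (X × X),
      Atil p = E (WithLp.equiv 2 (X × X) p).1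
        + (L / 2 + 1 / (3 * δt))
          * ‖(WithLp.equiv 2 (X × X) p).1 - (WithLp.equiv 2 (X × X) p).2‖ ^ 2
        + (1 / 6) * ⟪M ((WithLp.equiv 2 (X × X) p).1 - (WithLp.equiv 2 (X × X) p).2),
            (WithLp.equiv 2 (X × X) p).1 - (WithLp.equiv 2 (X × X) p).2⟫)
    (hKL : ∀ p : WithLp 2 (X × X), gradient Atil p = 0 → KLPropertyAt Atil p) :
    Filter.Tendsto (fun n : ℕ =>
        ‖gradient Atil ((WithLp.equiv 2 (X × X)).symm (u (n + 1), u n))‖)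
      atTop (𝓝 0) ∧
    (Antitone fun n : ℕ => Atil ((WithLp.equiv 2 (X × X)).symm (u (n + 1), u n))) ∧
    (∃ ζ : ℝ, Tendsto (fun n : ℕ => Atil ((WithLp.equiv 2 (X × X)).symm (u (n + 1), u n)))
      atTop (𝓝 ζ)) ∧
    Bornology.IsBounded (Set.range u) ∧
    Summable (fun n : ℕ => ‖u (n + 1) - u n‖) ∧
    ∃ ustar : X, Tendsto u atTop (𝓝 ustar) ∧ h ustar + f ustar = 0 := by
  set K : ℝ := L / 2 + 1 / (3 * δt) with hK
  have hK0 : 0 < K := by positivity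
  set Λ := lamMax
  have hΛ0 : 0 ≤ Λ := (hlam0 0).trans (hlamMax 0)
  obtain ⟨hΛ1, hΛ2⟩ := lt_min_iff.1 hlamBound
  have hδL : 3 * δt * L < 2 := by
    rw [lt_div_iff₀ (by positivity)] at hδt2
    linarith
  have hΛ5 : (1 + Λ) ^ 2 ≤ 5 := by
    have := (Real.lt_sqrt (by positivity)).1 (show 1 + Λ < √5 by linarith)
    exact this.le
  set c : ℝ := (4 / (3 * δt) - L / 2) / (1 + Λ) ^ 2 - L with hc
  have hcpos : 0 < c := by
    have := (Real.lt_sqrt (by positivity)).1 (lt_sub_iff_add_lt'.1 hΛ1)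
    rw [lt_div_iff₀ (by positivity)] at this
    rw [hc, sub_pos, lt_div_iff₀ (by positivity), lt_sub_iff_add_lt, lt_div_iff₀ (by positivity)]
    linarith
  set q : ℕ → WithLp 2 (X × X) := fun n => WithLp.toLp 2 (u (n + 1), u n) with hq
  change Tendsto (fun n => ‖gradient Atil (q n)‖) atTop (𝓝 0) ∧
    (Antitone fun n => Atil (q n)) ∧ (∃ ζ : ℝ, Tendsto (fun n => Atil (q n)) atTop (𝓝 ζ)) ∧ _
  set a : ℕ → ℝ := fun n => ‖u (n + 1) - u n‖ with ha
  have ha0 (n : ℕ) : 0 ≤ a n := norm_nonneg _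
  have hAq (n : ℕ) : Atil (q n) = E (u (n + 1)) + K * a n ^ 2
      + 1 / 6 * ⟪M (u (n + 1) - u n), u (n + 1) - u n⟫ := hAtil _
  have hdesc (n : ℕ) : Atil (q (n + 1)) + c * a (n + 1) ^ 2 ≤ Atil (q n) := by
    have hls' := hls (n + 1)
    rw [← hupd, hEn, hEn, hHn, hHn, hFn, hFn, Nat.add_sub_cancel] at hls'
    have hdrop : 0 ≤ α * lam (n + 1) * ‖y (n + 1) - u (n + 1)‖ ^ 2 := by
      have := hlam0 (n + 1)
      positivity
    have := modified_energy_descent hH hHconv hF hLip hL.le hδt (by linarith) hMsym hMpsd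
      (hlam0 (n + 1)) (hlamMax (n + 1)) hΛ5 (hopt (n + 1)) (hupd (n + 1))
      (by rw [Nat.add_sub_cancel]; linarith)
    rw [Nat.add_sub_cancel] at this
    rw [hAq, hAq, hE, hE]
    exact this
  -- the gradient of the modified energy
  set G : X →L[ℝ] X := (2 * K) • ContinuousLinearMap.id ℝ X + (1 / 3 : ℝ) • M with hG
  have hGsym (v w : X) : ⟪G v, w⟫ = ⟪v, G w⟫ := by
    simp [hG, inner_add_left, inner_add_right, inner_smul_left, inner_smul_right, hMsym]
  have hEgrad (x : X) : HasGradientAt E (h x + f x) x := by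
    rw [hasGradientAt_iff_hasFDerivAt, map_add, show E = H + F from funext hE]
    exact (hH x).hasFDerivAt.add (hF x).hasFDerivAt
  have hAfun : Atil = fun p : WithLp 2 (X × X) =>
      E p.fst + 1 / 2 * ⟪G (p.fst - p.snd), p.fst - p.snd⟫ := by
    funext p
    rw [hAtil]
    change E p.fst + K * ‖p.fst - p.snd‖ ^ 2 + 1 / 6 * ⟪M (p.fst - p.snd), p.fst - p.snd⟫ = _
    rw [hG, add_apply, inner_add_left]
    simp only [smul_apply, ContinuousLinearMap.id_apply, inner_smul_left,
      real_inner_self_eq_norm_sq, RCLike.conj_to_real]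
    ring
  have hAgrad (p : WithLp 2 (X × X)) : HasGradientAt Atil (WithLp.toLp 2
      (h p.fst + f p.fst + G (p.fst - p.snd), -G (p.fst - p.snd))) p := by
    rw [hAfun]
    exact hasGradientAt_add_half_inner_sub (hEgrad p.fst) hGsym p.snd
  have hhcont : Continuous h :=
    (LipschitzWith.of_dist_le_mul (K := ⟨Lh, hLh⟩) fun x y => by
      rw [dist_eq_norm, dist_eq_norm]; exact hhLip x y).continuous
  have hfcont : Continuous f :=
    (LipschitzWith.of_dist_le_mul (K := ⟨L, hL.le⟩) fun x y => by
      rw [dist_eq_norm, dist_eq_norm]; exact hLip x y).continuous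
  have hgradcont : Continuous (gradient Atil) := by
    rw [gradient_eq hAgrad]
    fun_prop
  have hAcont : Continuous Atil :=
    continuous_iff_continuousAt.2 fun p => (hAgrad p).continuousAt
  have hnorm (v w : X) : ‖(WithLp.toLp 2 (v, w) : WithLp 2 (X × X))‖ ≤ ‖v‖ + ‖w‖ := by
    rw [WithLp.prod_norm_eq_of_L2]
    exact Real.sqrt_le_iff.2 ⟨by positivity, by
      have := mul_nonneg (norm_nonneg v) (norm_nonneg w)
      change ‖v‖ ^ 2 + ‖w‖ ^ 2 ≤ _
      nlinarith⟩
  set C : ℝ := 2 / δt + ‖M‖ + Lh + L + 2 * ‖G‖ with hC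
  have hCpos : 0 < C := by positivity
  have hgrad (n : ℕ) : ‖gradient Atil (q (n + 1))‖ ≤ C * (a (n + 1) + a n) := by
    rw [(hAgrad _).gradient]
    have h1 := norm_gradient_le_of_optimality hLh hδt hLip hhLip (hlam0 (n + 1)) (hopt (n + 1))
      (hupd (n + 1))
    have h2 : ‖G (u (n + 1 + 1) - u (n + 1))‖ ≤ ‖G‖ * a (n + 1) := G.le_opNorm _
    have h3 : 0 ≤ ‖G‖ * a n := mul_nonneg (norm_nonneg _) (ha0 n)
    have h4 : ‖h (u (n + 1 + 1)) + f (u (n + 1 + 1))‖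
        ≤ (2 / δt + ‖M‖ + Lh + L) * (a (n + 1) + a n) := h1
    refine (hnorm _ _).trans ?_
    rw [norm_neg]
    refine (add_le_add_left (norm_add_le _ _) _).trans ?_
    change ‖h (u (n + 1 + 1)) + f (u (n + 1 + 1))‖ + ‖G (u (n + 1 + 1) - u (n + 1))‖
      + ‖G (u (n + 1 + 1) - u (n + 1))‖ ≤ _
    rw [hC]
    linarith
  have hdist (n : ℕ) : dist (q (n + 1)) (q n) ≤ a (n + 1) + a n := by
    rw [dist_eq_norm]
    exact hnorm _ _
  have hanti : Antitone fun n => Atil (q n) :=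
    antitone_nat_of_succ_le fun n => by
      have := hdesc n
      have : 0 ≤ c * a (n + 1) ^ 2 := by positivity
      linarith
  have hEA (n : ℕ) : E (u (n + 1)) ≤ Atil (q n) := by
    have := hMpsd (u (n + 1) - u n)
    have : 0 ≤ K * a n ^ 2 := by positivity
    rw [hAq]
    linarith
  have hbdd : Bornology.IsBounded (Set.range u) := by
    refine (hlevel (max (E (u 0)) (Atil (q 0)))).subset ?_
    rintro _ ⟨_ | n, rfl⟩
    · exact le_max_left (E (u 0)) _
    · exact ((hEA n).trans (hanti n.zero_le)).trans (le_max_right _ _)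
  have hEcont : Continuous E := continuous_iff_continuousAt.2 fun x => (hEgrad x).continuousAt
  obtain ⟨m, hm⟩ := hbdd.isCompact_closure.bddBelow_image hEcont.continuousOn
  have hlim : Tendsto (fun n => Atil (q n)) atTop (𝓝 (⨅ n, Atil (q n))) := by
    refine tendsto_atTop_ciInf hanti ⟨m, ?_⟩
    rintro _ ⟨n, rfl⟩
    exact (hm ⟨_, subset_closure ⟨n + 1, rfl⟩, rfl⟩).trans (hEA n)
  have hato : Tendsto a atTop (𝓝 0) := tendsto_zero_of_sufficient_decrease hcpos hdesc hlim
  have hgradto : Tendsto (fun n => ‖gradient Atil (q n)‖) atTop (𝓝 0) := by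
    rw [← tendsto_add_atTop_iff_nat 1]
    refine squeeze_zero (fun n => norm_nonneg _) hgrad ?_
    simpa using (((tendsto_add_atTop_iff_nat 1).2 hato).add hato).const_mul C
  -- accumulation points of the iterates
  obtain ⟨ustar, -, φ, hφ, hφlim⟩ := tendsto_subseq_of_bounded hbdd fun n => Set.mem_range_self n
  have hφlim' : Tendsto (fun k => u (φ k + 1)) atTop (𝓝 ustar) := by
    have h1 : Tendsto (fun k => u (φ k + 1) - u (φ k)) atTop (𝓝 0) :=
      (tendsto_zero_iff_norm_tendsto_zero.2 hato).comp hφ.tendsto_atTop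
    simpa using h1.add hφlim
  set p : WithLp 2 (X × X) := WithLp.toLp 2 (ustar, ustar) with hp
  have hqφ : Tendsto (q ∘ φ) atTop (𝓝 p) :=
    ((WithLp.prod_continuous_toLp 2 X X).tendsto _).comp (hφlim'.prodMk_nhds hφlim)
  have hcluster : MapClusterPt p atTop q := hqφ.mapClusterPt.of_comp hφ.tendsto_atTop
  have hgradp : gradient Atil p = 0 := by
    refine tendsto_nhds_unique ((hgradcont.tendsto p).comp hqφ) ?_
    exact (tendsto_zero_iff_norm_tendsto_zero.2 hgradto).comp hφ.tendsto_atTop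
  have hlimp : Tendsto (fun n => Atil (q n)) atTop (𝓝 (Atil p)) := by
    rwa [tendsto_nhds_unique ((hAcont.tendsto p).comp hqφ) (hlim.comp hφ.tendsto_atTop)]
  have hsum : Summable a := (hKL p hgradp).summable_of_sufficient_decrease hcpos hCpos ha0 hdesc
    hgrad hdist hcluster hlimp
  have hconv : Tendsto u atTop (𝓝 ustar) := by
    have hcauchy : CauchySeq u := cauchySeq_of_summable_dist <|
      hsum.congr fun n => by rw [dist_eq_norm, norm_sub_rev]
    exact tendsto_nhds_of_cauchySeq_of_subseq hcauchy hφ.tendsto_atTop hφlim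
  refine ⟨hgradto, hanti, ⟨_, hlim⟩, hbdd, hsum, ustar, hconv, ?_⟩
  rw [(hAgrad p).gradient] at hgradp
  simpa [hp] using congrArg WithLp.fst hgradp
end
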